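/- Let (C, J) be a site. The category of J-sheaves of types on C is an elementary topos: it has all finite limits, it is cartesian closed (for all sheaves A, B there is an exponential sheaf B^A with the adjunction Hom(X × A, B) ≅ Hom(X, B^A) natural in X), and it has a subobject classifier, i.e., an object Ω with a morphism true : 1 → Ω from the terminal object such that every monomorphism A ↪ X arises as the pullback of true along a unique morphism χ : X → Ω. -/

import Mathlib

open CategoryTheory CategoryTheory.Limits

open MonoidalCategory CartesianMonoidalCategory MonoidalClosed in
/-- In a cartesian closed category, the exponential represents maps out of the chosen binary
products, naturally in the first factor. -/
theorem CategoryTheory.MonoidalClosed.exists_prodHomEquiv {D : Type*} [Category D]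
    [CartesianMonoidalCategory D] [MonoidalClosed D] [HasBinaryProducts D] (A B : D) :
    ∃ E : D, ∃ e : ∀ X : D, (X ⨯ A ⟶ B) ≃ (X ⟶ E),
      ∀ (X Y : D) (h : Y ⟶ X) (φ : X ⨯ A ⟶ B),
        e Y (prod.map h (𝟙 A) ≫ φ) = h ≫ e X φ := by
  let i (X : D) : X ⨯ A ≅ A ⊗ X :=
    { hom := lift prod.snd prod.fst
      inv := prod.lift (snd A X) (fst A X)
      inv_hom_id := by
        ext
        · simp [prod.lift_snd (snd A X) (fst A X)]
        · simpa using prod.lift_fst (snd A X) (fst A X) }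
  refine ⟨(ihom A).obj B,
    fun X ↦ (i X).homCongr (Iso.refl B) |>.trans ((ihom.adjunction A).homEquiv X B),
    fun X Y h φ ↦ ?_⟩
  have hi : (i Y).inv ≫ prod.map h (𝟙 A) = A ◁ h ≫ (i X).inv := by
    ext <;> simp [i]
  simp only [Equiv.trans_apply, Iso.homCongr_apply, Iso.refl_hom, Category.comp_id]
  rw [reassoc_of% hi]
  exact Adjunction.homEquiv_naturality_left _ _ _

/-- The domain of the truth morphism of a subobject classifier can be taken to be the chosen
terminal object. -/
theorem CategoryTheory.Subobject.Classifier.exists_terminal_truth {D : Type*} [Category D]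
    [HasTerminal D] (c : Subobject.Classifier D) :
    ∃ (Ω : D) (t : ⊤_ D ⟶ Ω), ∀ (X A : D) (m : A ⟶ X), Mono m →
      ∃! χ : X ⟶ Ω, IsPullback (terminal.from A) m t χ := by
  let i : c.Ω₀ ≅ ⊤_ D := c.isTerminalΩ₀.uniqueUpToIso terminalIsTerminal
  refine ⟨c.Ω, i.inv ≫ c.truth, fun X A m _ ↦ ⟨c.χ m, ?_, fun χ' h ↦ ?_⟩⟩
  · exact (c.isPullback m).flip.of_iso (Iso.refl _) i (Iso.refl _) (Iso.refl _)
      (Subsingleton.elim _ _) (by simp) (by simp) (by simp)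
  · exact c.uniq m (χ₀' := terminal.from A ≫ i.inv)
      (h.of_iso (Iso.refl _) i.symm (Iso.refl _) (Iso.refl _)
        (by simp) (by simp) (by simp) (by simp)).flip

/-- **The category of sheaves on a site is an elementary topos.**
For a site `(C, J)`, the category of `J`-sheaves of types has all finite limits,
is cartesian closed (every pair of sheaves `A`, `B` admits an exponential `E = B^A`
with a bijection `Hom(X ⨯ A, B) ≅ Hom(X, E)` natural in `X`), and has a subobject
classifier: an object `Ω` with `true : ⊤_ ⟶ Ω` such that every monomorphism
`m : A ⟶ X` is the pullback of `true` along a unique `χ : X ⟶ Ω`. -/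
theorem sheafCategory_isElementaryTopos
    {C : Type u} [Category.{v} C] (J : GrothendieckTopology C) :
    HasFiniteLimits (Sheaf J (Type max u v)) ∧
    (∀ A B : Sheaf J (Type max u v), ∃ E : Sheaf J (Type max u v),
      ∃ e : ∀ X : Sheaf J (Type max u v), (X ⨯ A ⟶ B) ≃ (X ⟶ E),
        ∀ (X Y : Sheaf J (Type max u v)) (h : Y ⟶ X) (φ : X ⨯ A ⟶ B),
          e Y (prod.map h (𝟙 A) ≫ φ) = h ≫ e X φ) ∧
    (∃ (Ω : Sheaf J (Type max u v)) (t : ⊤_ (Sheaf J (Type max u v)) ⟶ Ω),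
      ∀ (X A : Sheaf J (Type max u v)) (m : A ⟶ X), Mono m →
        ∃! χ : X ⟶ Ω, IsPullback (terminal.from A) m t χ) := by
  let _ : MonoidalClosed (Cᵒᵖ ⥤ Type max u v) := cartesianClosedFunctorToTypes.{v, u, max u v}
  let this : MonoidalClosed (Sheaf J (Type max u v)) := inferInstance
  exact ⟨inferInstance, @MonoidalClosed.exists_prodHomEquiv (Sheaf J (Type max u v)) _ _ this _,
    (Sheaf.classifier J).exists_terminal_truth⟩
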